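/- Let F be a finite field and let M ∈ F⟨x₁,…,x_n⟩^{d×d} be a full matrix that is not a unit. Then there exist r ≥ 1 and matrices M₁, M₂, …, M_r ∈ F⟨x₁,…,x_n⟩^{d×d}, each of which is an atom, such that M = M₁·M₂⋯M_r. -/

import Mathlib

/-- A square matrix `M` over a ring `R` is *full* if it cannot be written as a product
`A·B` with `A` of size `d × r`, `B` of size `r × d` and `r < d`. -/
def Matrix.IsFullMat {R : Type*} [Ring R] {d : ℕ} (M : Matrix (Fin d) (Fin d) R) : Prop :=
  ¬ ∃ (r : ℕ) (_ : r < d) (A : Matrix (Fin d) (Fin r) R) (B : Matrix (Fin r) (Fin d) R),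
      M = A * B

/-- A full non-unit square matrix `M` is an *atom* if in any factorization `M = A·B`
one of the factors is a unit of the matrix ring. -/
def Matrix.IsAtomMat {R : Type*} [Ring R] {d : ℕ} (M : Matrix (Fin d) (Fin d) R) : Prop :=
  Matrix.IsFullMat M ∧ ¬ IsUnit M ∧
    ∀ A B : Matrix (Fin d) (Fin d) R, M = A * B → IsUnit A ∨ IsUnit B

namespace MonoidAlgebra

variable {F X : Type*} [Field F]

/-- The span of the words of length less than `m`. -/
noncomputable def lengthLT (F X : Type*) [Field F] (m : ℕ) :
    Submodule F (MonoidAlgebra F (FreeMonoid X)) :=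
  supported F F {w | w.length < m}

/-- One more than the degree of a noncommutative polynomial, and `0` for the zero polynomial. -/
noncomputable def size (f : MonoidAlgebra F (FreeMonoid X)) : ℕ :=
  f.coeff.support.sup fun w => w.length + 1

theorem mem_lengthLT_iff {m : ℕ} {f : MonoidAlgebra F (FreeMonoid X)} :
    f ∈ lengthLT F X m ↔ ∀ w, f.coeff w ≠ 0 → w.length < m := by
  rw [lengthLT, mem_supported']
  exact forall_congr' fun w => not_imp_comm

theorem size_le_iff {m : ℕ} {f : MonoidAlgebra F (FreeMonoid X)} :
    size f ≤ m ↔ f ∈ lengthLT F X m := by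
  rw [mem_lengthLT_iff, size, Finset.sup_le_iff]
  simp only [Finsupp.mem_support_iff, Nat.lt_iff_add_one_le]

theorem lengthLT_mono {m k : ℕ} (h : m ≤ k) : lengthLT F X m ≤ lengthLT F X k :=
  supported_mono fun _ hw => lt_of_lt_of_le hw h

theorem lengthLT_eq_span (m : ℕ) :
    lengthLT F X m = Submodule.span F ((fun w => single w 1) '' {w | w.length < m}) :=
  supported_eq_span_single _ _

theorem exists_length_eq_of_size_eq {s : ℕ} {f : MonoidAlgebra F (FreeMonoid X)}
    (h : size f = s + 1) : ∃ w, w.length = s ∧ f.coeff w ≠ 0 := by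
  have h' : ¬ f ∈ lengthLT F X s := by rw [← size_le_iff]; omega
  rw [mem_lengthLT_iff] at h'
  push Not at h'
  obtain ⟨w, hw, hs⟩ := h'
  have := mem_lengthLT_iff.1 (size_le_iff.1 h.le) w hw
  exact ⟨w, by omega, hw⟩

theorem size_eq_zero_iff {f : MonoidAlgebra F (FreeMonoid X)} : size f = 0 ↔ f = 0 := by
  rw [← Nat.le_zero, size_le_iff, mem_lengthLT_iff]
  constructor
  · intro h
    ext w
    by_contra hw
    exact absurd (h w hw) (by simp)
  · rintro rfl
    simp

instance finite_lengthLT [Finite X] (m : ℕ) : Module.Finite F (lengthLT F X m) := by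
  rw [lengthLT_eq_span]
  exact Module.Finite.span_of_finite F ((List.finite_length_lt X m).image _)

theorem mul_mem_lengthLT {p q : ℕ} {a b : MonoidAlgebra F (FreeMonoid X)}
    (ha : a ∈ lengthLT F X p) (hb : b ∈ lengthLT F X (q + 1)) : a * b ∈ lengthLT F X (p + q) := by
  classical
  rw [mem_lengthLT_iff] at *
  intro w hw
  obtain ⟨u, hu, v, hv, rfl⟩ := Finset.mem_mul.1
    (support_coeff_mul_subset a b (Finsupp.mem_support_iff.2 hw))
  have h₁ := ha u (Finsupp.mem_support_iff.1 hu)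
  have h₂ := hb v (Finsupp.mem_support_iff.1 hv)
  rw [FreeMonoid.length_mul]
  omega

/-- The transduction removing the prefix `w` from words, and killing the words not starting
with `w`. -/
noncomputable def stripPrefix (w : FreeMonoid X) :
    MonoidAlgebra F (FreeMonoid X) →ₗ[F] MonoidAlgebra F (FreeMonoid X) :=
  (coeffLinearEquiv F).symm.toLinearMap ∘ₗ
    Finsupp.lcomapDomain (w * ·) (mul_right_injective w) ∘ₗ (coeffLinearEquiv F).toLinearMap

@[simp]
theorem coeff_stripPrefix (w v : FreeMonoid X) (f : MonoidAlgebra F (FreeMonoid X)) :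
    (stripPrefix w f).coeff v = f.coeff (w * v) := rfl

theorem stripPrefix_mem_lengthLT {w : FreeMonoid X} {m : ℕ} {f : MonoidAlgebra F (FreeMonoid X)}
    (hf : f ∈ lengthLT F X (w.length + m)) : stripPrefix w f ∈ lengthLT F X m := by
  rw [mem_lengthLT_iff] at *
  intro v hv
  have := hf _ hv
  rw [FreeMonoid.length_mul] at this
  omega

theorem stripPrefix_single_mul (w v : FreeMonoid X) (r : F) :
    stripPrefix w (single (w * v) r) = single v r := by
  classical
  ext z
  simp [Finsupp.single_apply]

theorem stripPrefix_single_of_forall_ne {w u : FreeMonoid X} (h : ∀ v, u ≠ w * v) (r : F) :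
    stripPrefix w (single u r) = 0 := by
  classical
  ext z
  simp [h]

theorem stripPrefix_eq_single {w : FreeMonoid X} {f : MonoidAlgebra F (FreeMonoid X)}
    (hf : f ∈ lengthLT F X (w.length + 1)) : stripPrefix w f = single 1 (f.coeff w) := by
  classical
  rw [mem_lengthLT_iff] at hf
  ext v
  rw [coeff_stripPrefix, coeff_single, Finsupp.single_apply]
  split_ifs with h
  · rw [← h, mul_one]
  · by_contra hv
    have := hf _ hv
    rw [FreeMonoid.length_mul] at this
    exact h (FreeMonoid.length_eq_zero.1 (by omega)).symm

theorem stripPrefix_mul_sub_mem_lengthLT (w : FreeMonoid X) {t : ℕ}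
    (a : MonoidAlgebra F (FreeMonoid X)) {b : MonoidAlgebra F (FreeMonoid X)}
    (hb : b ∈ lengthLT F X (t + 1)) :
    stripPrefix w (a * b) - stripPrefix w a * b ∈ lengthLT F X t := by
  rw [lengthLT_eq_span] at hb
  induction hb using Submodule.span_induction with
  | zero => simp
  | add x y _ _ hx hy =>
    convert add_mem hx hy using 1
    simp only [mul_add, map_add]
    abel
  | smul r x _ hx =>
    convert Submodule.smul_mem _ r hx using 1
    simp only [mul_smul_comm, map_smul, smul_sub]
  | mem x hx =>
    obtain ⟨v, hv, rfl⟩ := hx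
    induction a using MonoidAlgebra.induction_linear with
    | zero => simp
    | add x y hx hy =>
      convert add_mem hx hy using 1
      simp only [add_mul, map_add]
      abel
    | single u r =>
      simp only [single_mul_single, mul_one]
      by_cases hu : ∃ u', u = w * u'
      · obtain ⟨u', rfl⟩ := hu
        simp [mul_assoc, stripPrefix_single_mul, single_mul_single]
      · push Not at hu
        rw [stripPrefix_single_of_forall_ne hu, zero_mul, sub_zero]
        by_cases hz : ∃ z, u * v = w * z
        · obtain ⟨z, hz⟩ := hz
          rw [hz, stripPrefix_single_mul]
          have hlen : z.length < t := by
            rcases List.append_eq_append_iff.1 hz with ⟨c, hw, hv'⟩ | ⟨c, hu', -⟩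
            · have hc : c ≠ [] := by
                rintro rfl
                exact hu 1 (by rw [mul_one]; exact (hw.trans (List.append_nil _)).symm)
              have h₁ : v.length = c.length + z.length := by
                exact (congrArg List.length hv').trans List.length_append
              have h₂ := List.length_pos_of_ne_nil hc
              have h₃ : v.length < t + 1 := hv
              omega
            · exact absurd hu' (hu c)
          rw [mem_lengthLT_iff]
          intro y hy
          classical
          rw [coeff_single, Finsupp.single_apply] at hy
          split_ifs at hy with h
          · exact h ▸ hlen
          · exact absurd rfl hy
        · push Not at hz
          rw [stripPrefix_single_of_forall_ne hz]
          exact zero_mem _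

/-- The largest size of an entry of a vector. -/
noncomputable def vecSize {ι : Type*} [Fintype ι] (b : ι → MonoidAlgebra F (FreeMonoid X)) : ℕ :=
  Finset.univ.sup fun i => size (b i)

theorem vecSize_le_iff {ι : Type*} [Fintype ι] {m : ℕ} {b : ι → MonoidAlgebra F (FreeMonoid X)} :
    vecSize b ≤ m ↔ ∀ i, b i ∈ lengthLT F X m := by
  rw [vecSize, Finset.sup_le_iff]
  exact ⟨fun h i => size_le_iff.1 (h i (Finset.mem_univ i)), fun h i _ => size_le_iff.2 (h i)⟩

theorem vecSize_eq_zero_iff {ι : Type*} [Fintype ι] {b : ι → MonoidAlgebra F (FreeMonoid X)} :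
    vecSize b = 0 ↔ b = 0 := by
  rw [← Nat.le_zero, vecSize_le_iff, funext_iff]
  exact forall_congr' fun i => by rw [← size_le_iff, Nat.le_zero, size_eq_zero_iff, Pi.zero_apply]

open Matrix in
/-- If a left linear combination of nonzero vectors has smaller degree than expected, then
one of the vectors can be replaced by one of smaller degree. -/
theorem exists_vecSize_add_lt {ι κ : Type*} [Fintype ι] [DecidableEq ι] [Fintype κ]
    (b : Matrix ι κ (MonoidAlgebra F (FreeMonoid X))) (hb : ∀ k, b k ≠ 0)
    (a : ι → MonoidAlgebra F (FreeMonoid X)) {k : ι} (hk : a k ≠ 0)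
    (h : vecSize (a ᵥ* b) + 1 < size (a k) + vecSize (b k)) :
    ∃ j, ∃ c : ι → MonoidAlgebra F (FreeMonoid X), c j = 0 ∧
      vecSize (b j + c ᵥ* b) < vecSize (b j) := by
  classical
  obtain ⟨j, hj, hmax⟩ := Finset.exists_max_image (Finset.univ.filter fun i => a i ≠ 0)
    (fun i => toLex (size (a i) + vecSize (b i), vecSize (b i))) ⟨k, by simpa using hk⟩
  replace hj : a j ≠ 0 := by simpa using hj
  have hmax' : ∀ i, a i ≠ 0 → size (a i) + vecSize (b i) < size (a j) + vecSize (b j) ∨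
      size (a i) + vecSize (b i) = size (a j) + vecSize (b j) ∧ vecSize (b i) ≤ vecSize (b j) :=
    fun i hi => by simpa [Prod.Lex.toLex_le_toLex] using hmax i (by simpa using hi)
  have hjk : size (a k) + vecSize (b k) ≤ size (a j) + vecSize (b j) := by
    rcases hmax' k hk with h | h <;> omega
  obtain ⟨s, hs⟩ := Nat.exists_eq_succ_of_ne_zero (mt size_eq_zero_iff.1 hj)
  obtain ⟨t, ht⟩ := Nat.exists_eq_succ_of_ne_zero (mt vecSize_eq_zero_iff.1 (hb j))
  obtain ⟨w, hw, hcoeff⟩ := exists_length_eq_of_size_eq hs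
  have key : ∀ i l, stripPrefix w (a i * b i l) - stripPrefix w (a i) * b i l
      ∈ lengthLT F X t := by
    intro i l
    by_cases hi : a i = 0
    · simp [hi]
    by_cases hbi : vecSize (b i) ≤ t + 1
    · exact stripPrefix_mul_sub_mem_lengthLT w _ (vecSize_le_iff.1 hbi l)
    have hlt : size (a i) + vecSize (b i) < size (a j) + vecSize (b j) := by
      rcases hmax' i hi with h | h <;> omega
    have hi0 : stripPrefix w (a i) = 0 := by
      rw [← size_eq_zero_iff, ← Nat.le_zero, size_le_iff]
      exact stripPrefix_mem_lengthLT (size_le_iff.1 (by omega))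
    rw [hi0, zero_mul, sub_zero]
    apply stripPrefix_mem_lengthLT
    obtain ⟨q, hq⟩ := Nat.exists_eq_succ_of_ne_zero (mt vecSize_eq_zero_iff.1 (hb i))
    exact lengthLT_mono (by omega) (mul_mem_lengthLT (size_le_iff.1 le_rfl)
      (vecSize_le_iff.1 hq.le l))
  have hsum : ∀ l, ∑ i, stripPrefix w (a i) * b i l ∈ lengthLT F X t := by
    intro l
    have h₁ : stripPrefix w ((a ᵥ* b) l) ∈ lengthLT F X t :=
      stripPrefix_mem_lengthLT (vecSize_le_iff.1 (by omega) l)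
    have h₂ := sub_mem h₁ (sum_mem fun i (_ : i ∈ Finset.univ) => key i l)
    rw [Finset.sum_sub_distrib, ← map_sum] at h₂
    simpa [vecMul, dotProduct] using h₂
  have hsj : stripPrefix w (a j) = algebraMap F _ ((a j).coeff w) := by
    rw [stripPrefix_eq_single (size_le_iff.1 (by omega))]
    rfl
  refine ⟨j, Function.update (fun i => ((a j).coeff w)⁻¹ • stripPrefix w (a i)) j 0, by simp, ?_⟩
  rw [ht, Nat.lt_succ_iff, vecSize_le_iff]
  intro l
  convert Submodule.smul_mem _ ((a j).coeff w)⁻¹ (hsum l) using 1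
  rw [Pi.add_apply, vecMul, dotProduct, ← Finset.add_sum_erase _ _ (Finset.mem_univ j),
    ← Finset.add_sum_erase _ _ (Finset.mem_univ j), smul_add, Finset.smul_sum, hsj]
  congr 1
  · rw [← Algebra.smul_def, smul_smul, inv_mul_cancel₀ hcoeff, one_smul]
  · rw [Function.update_self, zero_mul, zero_add]
    refine Finset.sum_congr rfl fun i hi => ?_
    rw [Function.update_of_ne (Finset.ne_of_mem_erase hi), smul_mul_assoc]

end MonoidAlgebra

namespace Matrix

section Ring

variable {R : Type*} [Ring R] {d : ℕ}

theorem IsFullMat.left {A B : Matrix (Fin d) (Fin d) R} (h : IsFullMat (A * B)) : IsFullMat A := by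
  rintro ⟨r, hr, P, Q, rfl⟩
  exact h ⟨r, hr, P, Q * B, Matrix.mul_assoc _ _ _⟩

theorem IsFullMat.right {A B : Matrix (Fin d) (Fin d) R} (h : IsFullMat (A * B)) :
    IsFullMat B := by
  rintro ⟨r, hr, P, Q, rfl⟩
  exact h ⟨r, hr, A * P, Q, (Matrix.mul_assoc _ _ _).symm⟩

theorem IsFullMat.row_ne_zero {B : Matrix (Fin d) (Fin d) R} (h : IsFullMat B) (k : Fin d) :
    B k ≠ 0 := by
  intro hk
  cases d with
  | zero => exact k.elim0
  | succ d =>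
    refine h ⟨d, d.lt_succ_self, (1 : Matrix _ _ R).submatrix id k.succAbove,
      B.submatrix k.succAbove id, ?_⟩
    conv_lhs => rw [← Matrix.one_mul B]
    ext i l
    rw [Matrix.mul_apply, Matrix.mul_apply, Fin.sum_univ_succAbove _ k, hk, Pi.zero_apply,
      mul_zero, zero_add]
    rfl

theorem IsFullMat.exists_apply_ne_zero {B : Matrix (Fin d) (Fin d) R} (h : IsFullMat B)
    (k : Fin d) : ∃ i, B i k ≠ 0 := by
  by_contra! hk
  cases d with
  | zero => exact k.elim0
  | succ d =>
    refine h ⟨d, d.lt_succ_self, B.submatrix id k.succAbove,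
      (1 : Matrix _ _ R).submatrix k.succAbove id, ?_⟩
    conv_lhs => rw [← Matrix.mul_one B]
    ext i l
    rw [Matrix.mul_apply, Matrix.mul_apply, Fin.sum_univ_succAbove _ k, hk, zero_mul, zero_add]
    rfl

theorem IsFullMat.units_mul {B : Matrix (Fin d) (Fin d) R} (h : IsFullMat B)
    (U : (Matrix (Fin d) (Fin d) R)ˣ) : IsFullMat (U.1 * B) := by
  apply IsFullMat.right (A := (U⁻¹).1)
  rwa [← Matrix.mul_assoc, Units.inv_mul, Matrix.one_mul]

theorem isUnit_one_add_vecMulVec_single {ι : Type*} [Fintype ι] [DecidableEq ι] (j : ι)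
    {c : ι → R} (hc : c j = 0) : IsUnit (1 + vecMulVec (Pi.single j 1) c) := by
  refine IsNilpotent.isUnit_one_add ⟨2, ?_⟩
  rw [pow_two, vecMulVec_mul_vecMulVec]
  simp [hc]

theorem IsFullMat.map_ringEquiv {S : Type*} [Ring S] (e : R ≃+* S)
    {A : Matrix (Fin d) (Fin d) R} (h : IsFullMat A) : IsFullMat (e.mapMatrix A) := by
  rintro ⟨r, hr, P, Q, hPQ⟩
  refine h ⟨r, hr, P.map e.symm, Q.map e.symm, ?_⟩
  rw [← Matrix.map_mul, ← hPQ]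
  ext i j
  simp

theorem IsAtomMat.map_ringEquiv {S : Type*} [Ring S] (e : R ≃+* S)
    {A : Matrix (Fin d) (Fin d) R} (h : IsAtomMat A) : IsAtomMat (e.mapMatrix A) := by
  refine ⟨h.1.map_ringEquiv e, fun hu => h.2.1 ?_, fun P Q hPQ => ?_⟩
  · exact (MulEquiv.isUnit_map (e.mapMatrix (m := Fin d))).1 hu
  · have := h.2.2 (e.mapMatrix.symm P) (e.mapMatrix.symm Q) (by
      rw [← map_mul, ← hPQ, RingEquiv.symm_apply_apply])
    rwa [MulEquiv.isUnit_map, MulEquiv.isUnit_map] at this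

/-- If the lengths of the factorizations of a full non-unit matrix into non-units are bounded,
then the matrix is a product of atoms. -/
theorem IsFullMat.exists_list_isAtomMat {M : Matrix (Fin d) (Fin d) R} (hM : IsFullMat M)
    (hu : ¬ IsUnit M) (N : ℕ)
    (hN : ∀ l : List (Matrix (Fin d) (Fin d) R), (∀ A ∈ l, ¬ IsUnit A) → l.prod = M →
      l.length ≤ N) :
    ∃ l : List (Matrix (Fin d) (Fin d) R), l ≠ [] ∧ (∀ A ∈ l, IsAtomMat A) ∧ l.prod = M := by
  let S : Set (List (Matrix (Fin d) (Fin d) R)) := {l | (∀ A ∈ l, ¬ IsUnit A) ∧ l.prod = M}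
  obtain ⟨l, ⟨hl, hprod⟩, hmax⟩ := WellFounded.has_min
    (measure fun l : List (Matrix (Fin d) (Fin d) R) => N - l.length).wf S ⟨[M], by simp [S, hu]⟩
  refine ⟨l, ?_, fun A hA => ?_, hprod⟩
  · rintro rfl
    exact hu (hprod ▸ isUnit_one)
  · obtain ⟨s, t, rfl⟩ := List.append_of_mem hA
    rw [List.prod_append, List.prod_cons] at hprod
    refine ⟨(hprod ▸ hM).right.left, hl A hA, fun P Q hPQ => ?_⟩
    by_contra! hn
    have hmem : s ++ P :: Q :: t ∈ S := by
      refine ⟨fun C hC => ?_, ?_⟩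
      · simp only [List.mem_append, List.mem_cons] at hC hl
        rcases hC with h | rfl | rfl | h
        exacts [hl C (.inl h), hn.1, hn.2, hl C (.inr (.inr h))]
      · rw [← hprod, hPQ, List.prod_append, List.prod_cons, List.prod_cons, Matrix.mul_assoc P]
    refine hmax _ hmem ?_
    have := hN _ hmem.1 hmem.2
    change N - (s ++ P :: Q :: t).length < N - (s ++ A :: t).length
    simp only [List.length_append, List.length_cons] at this ⊢
    omega

end Ring

section FreeMonoidAlgebra

open MonoidAlgebra

variable {F X : Type*} [Field F] {d : ℕ}

/-- A full matrix can be row reduced so that the degree of a left linear combination of the rows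
is the maximum of the degrees of its terms. -/
theorem IsFullMat.exists_units_reduced
    {B : Matrix (Fin d) (Fin d) (MonoidAlgebra F (FreeMonoid X))} (hB : IsFullMat B) :
    ∃ U : (Matrix (Fin d) (Fin d) (MonoidAlgebra F (FreeMonoid X)))ˣ,
      ∀ (a : Fin d → MonoidAlgebra F (FreeMonoid X)) (k : Fin d), a k ≠ 0 →
        size (a k) + vecSize ((U.1 * B) k) ≤ vecSize (a ᵥ* (U.1 * B)) + 1 := by
  obtain ⟨U, -, hmin⟩ := WellFounded.has_min
    (measure fun U : (Matrix (Fin d) (Fin d) (MonoidAlgebra F (FreeMonoid X)))ˣ =>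
      ∑ k, vecSize ((U.1 * B) k)).wf Set.univ ⟨1, trivial⟩
  refine ⟨U, fun a k hk => ?_⟩
  by_contra! h
  obtain ⟨j, c, hc, hlt⟩ := exists_vecSize_add_lt _ (hB.units_mul U).row_ne_zero a hk h
  obtain ⟨T, hT⟩ := isUnit_one_add_vecMulVec_single j hc
  refine hmin (T * U) trivial ?_
  change ∑ k, vecSize (((T * U).1 * B) k) < ∑ k, vecSize ((U.1 * B) k)
  have hrow : ∀ i, ((T * U).1 * B) i =
      (U.1 * B) i + (Pi.single j 1 : Fin d → MonoidAlgebra F (FreeMonoid X)) i •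
        (c ᵥ* (U.1 * B)) := by
    intro i
    rw [Units.val_mul, Matrix.mul_assoc, hT, Matrix.add_mul, Matrix.one_mul, vecMulVec_mul]
    rfl
  refine Finset.sum_lt_sum (fun i _ => ?_) ⟨j, Finset.mem_univ j, ?_⟩
  · rw [hrow]
    obtain rfl | hij := eq_or_ne i j
    · simpa using hlt.le
    · simp [hij]
  · rw [hrow]
    simpa using hlt

theorem IsFullMat.eq_zero_of_vecMul_eq_zero
    {B : Matrix (Fin d) (Fin d) (MonoidAlgebra F (FreeMonoid X))} (hB : IsFullMat B)
    {c : Fin d → MonoidAlgebra F (FreeMonoid X)} (hc : c ᵥ* B = 0) : c = 0 := by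
  obtain ⟨U, hU⟩ := hB.exists_units_reduced
  have hz : (c ᵥ* (U⁻¹).1) ᵥ* (U.1 * B) = 0 := by
    rw [vecMul_vecMul, ← Matrix.mul_assoc, Units.inv_mul, Matrix.one_mul, hc]
  have h0 : c ᵥ* (U⁻¹).1 = 0 := by
    by_contra h
    obtain ⟨k, hk⟩ := Function.ne_iff.1 h
    have h₁ := hU _ k hk
    rw [hz, vecSize_eq_zero_iff.2 rfl] at h₁
    have h₂ := mt size_eq_zero_iff.1 hk
    have h₃ := mt vecSize_eq_zero_iff.1 ((hB.units_mul U).row_ne_zero k)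
    omega
  rw [← vecMul_one c, ← Units.inv_mul U, ← vecMul_vecMul, h0, zero_vecMul]

theorem IsFullMat.mul_right_cancel
    {B P Q : Matrix (Fin d) (Fin d) (MonoidAlgebra F (FreeMonoid X))} (hB : IsFullMat B)
    (h : P * B = Q * B) : P = Q := by
  rw [← sub_eq_zero]
  funext i
  apply hB.eq_zero_of_vecMul_eq_zero
  rw [← mul_apply_eq_vecMul, Matrix.sub_mul, h, sub_self]
  rfl

/-- The vectors with entries of degree less than `m` that are left combinations of the rows
of `B`. -/
noncomputable def rowSpaceLT (m : ℕ)
    (B : Matrix (Fin d) (Fin d) (MonoidAlgebra F (FreeMonoid X))) :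
    Submodule F (Fin d → MonoidAlgebra F (FreeMonoid X)) :=
  Submodule.pi Set.univ (fun _ => lengthLT F X m) ⊓
    LinearMap.range (B.vecMulLinear.restrictScalars F)

theorem mem_rowSpaceLT_iff {m : ℕ} {B : Matrix (Fin d) (Fin d) (MonoidAlgebra F (FreeMonoid X))}
    {v : Fin d → MonoidAlgebra F (FreeMonoid X)} :
    v ∈ rowSpaceLT m B ↔ vecSize v ≤ m ∧ ∃ c, c ᵥ* B = v := by
  rw [vecSize_le_iff, rowSpaceLT, Submodule.mem_inf, Submodule.mem_pi]
  simp

instance finite_rowSpaceLT [Finite X] (m : ℕ)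
    (B : Matrix (Fin d) (Fin d) (MonoidAlgebra F (FreeMonoid X))) :
    Module.Finite F (rowSpaceLT m B) := by
  have : Module.Finite F (Submodule.pi Set.univ fun _ : Fin d => lengthLT F X m) := by
    rw [← Submodule.iSup_map_single]
    infer_instance
  exact Submodule.finiteDimensional_of_le inf_le_left

theorem rowSpaceLT_mul_le (m : ℕ)
    (A B : Matrix (Fin d) (Fin d) (MonoidAlgebra F (FreeMonoid X))) :
    rowSpaceLT m (A * B) ≤ rowSpaceLT m B := by
  intro v hv
  obtain ⟨hv, c, rfl⟩ := mem_rowSpaceLT_iff.1 hv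
  exact mem_rowSpaceLT_iff.2 ⟨hv, c ᵥ* A, vecMul_vecMul _ _ _⟩

/-- Splitting off a non-unit left factor of a right factor of a full matrix enlarges the space of
left combinations of the rows whose degree is at most that of the full matrix. -/
theorem IsFullMat.rowSpaceLT_mul_lt {m : ℕ}
    {C A B : Matrix (Fin d) (Fin d) (MonoidAlgebra F (FreeMonoid X))}
    (h : IsFullMat (C * (A * B))) (hm : ∀ i, vecSize ((C * (A * B)) i) ≤ m) (hA : ¬ IsUnit A) :
    rowSpaceLT m (A * B) < rowSpaceLT m B := by
  refine lt_of_le_of_ne (rowSpaceLT_mul_le m A B) fun heq => hA ?_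
  have hB : IsFullMat B := h.right.right
  have hAfull : IsFullMat A := h.right.left
  obtain ⟨U, hU⟩ := hB.exists_units_reduced
  set D := C * A * (U⁻¹).1 with hD
  have hDU : D * (U.1 * B) = C * (A * B) := by
    rw [hD, ← Matrix.mul_assoc, Matrix.mul_assoc _ _ U.1, Units.inv_mul, Matrix.mul_one,
      Matrix.mul_assoc]
  have hrow : ∀ k, (U.1 * B) k ∈ rowSpaceLT m (A * B) := by
    intro k
    rw [heq, mem_rowSpaceLT_iff]
    refine ⟨?_, U.1 k, (mul_apply_eq_vecMul _ _ _).symm⟩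
    obtain ⟨i, hi⟩ := (hDU ▸ h).left.exists_apply_ne_zero k
    have h₁ := hU (D i) k hi
    rw [← mul_apply_eq_vecMul, hDU] at h₁
    have h₂ := mt size_eq_zero_iff.1 hi
    have h₃ := hm i
    omega
  choose Q hQ using fun k => (mem_rowSpaceLT_iff.1 (hrow k)).2
  have hQ' : Matrix.of Q * (A * B) = U.1 * B := by
    funext k
    rw [mul_apply_eq_vecMul]
    exact hQ k
  have hleft : (U⁻¹).1 * Matrix.of Q * A = 1 := by
    apply hB.mul_right_cancel
    rw [Matrix.mul_assoc, Matrix.mul_assoc, hQ', ← Matrix.mul_assoc, Units.inv_mul]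
  have hright : A * ((U⁻¹).1 * Matrix.of Q) = 1 := by
    apply hAfull.mul_right_cancel
    rw [Matrix.mul_assoc, hleft, Matrix.mul_one, Matrix.one_mul]
  exact ⟨⟨A, _, hright, hleft⟩, rfl⟩

theorem IsFullMat.length_le_finrank [Finite X] {m : ℕ}
    (l : List (Matrix (Fin d) (Fin d) (MonoidAlgebra F (FreeMonoid X))))
    (hl : ∀ A ∈ l, ¬ IsUnit A) (C : Matrix (Fin d) (Fin d) (MonoidAlgebra F (FreeMonoid X)))
    (h : IsFullMat (C * l.prod)) (hm : ∀ i, vecSize ((C * l.prod) i) ≤ m) :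
    l.length + Module.finrank F (rowSpaceLT m l.prod) ≤
      Module.finrank F (rowSpaceLT m (1 : Matrix (Fin d) (Fin d)
        (MonoidAlgebra F (FreeMonoid X)))) := by
  induction l generalizing C with
  | nil => exact (Nat.zero_add _).le
  | cons A t ih =>
    rw [List.prod_cons] at h hm ⊢
    have h₁ := Submodule.finrank_lt_finrank_of_lt
      (h.rowSpaceLT_mul_lt hm (hl A List.mem_cons_self))
    have h₂ := ih (fun P hP => hl P (List.mem_cons_of_mem _ hP)) (C * A)
      (by rwa [Matrix.mul_assoc]) (by rwa [Matrix.mul_assoc])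
    rw [List.length_cons]
    omega

theorem IsFullMat.exists_list_isAtomMat_of_freeMonoid [Finite X]
    {M : Matrix (Fin d) (Fin d) (MonoidAlgebra F (FreeMonoid X))} (hM : IsFullMat M)
    (hu : ¬ IsUnit M) :
    ∃ l : List (Matrix (Fin d) (Fin d) (MonoidAlgebra F (FreeMonoid X))),
      l ≠ [] ∧ (∀ A ∈ l, IsAtomMat A) ∧ l.prod = M := by
  refine hM.exists_list_isAtomMat hu (Module.finrank F (rowSpaceLT
    (Finset.univ.sup fun i => vecSize (M i)) (1 : Matrix (Fin d) (Fin d)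
      (MonoidAlgebra F (FreeMonoid X))))) fun l hl hprod => ?_
  have := IsFullMat.length_le_finrank (m := Finset.univ.sup fun i => vecSize (M i)) l hl 1
    (by rwa [Matrix.one_mul, hprod]) fun i => by
      rw [Matrix.one_mul, hprod]
      exact Finset.le_sup (f := fun i => vecSize (M i)) (Finset.mem_univ i)
  omega

end FreeMonoidAlgebra

end Matrix

/-- Every full non-unit matrix over `F_q⟨x₁,…,x_n⟩` (`F` a finite field) admits a complete
factorization into atoms. -/
theorem matrix_polynomial_factorization (F : Type*) [Field F] [Fintype F] (n d : ℕ)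
    (M : Matrix (Fin d) (Fin d) (FreeAlgebra F (Fin n)))
    (hfull : Matrix.IsFullMat M) (hnonunit : ¬ IsUnit M) :
    ∃ (r : ℕ) (_ : 1 ≤ r) (Ms : Fin r → Matrix (Fin d) (Fin d) (FreeAlgebra F (Fin n))),
      (∀ i, Matrix.IsAtomMat (Ms i)) ∧ M = (List.ofFn Ms).prod := by
  let e : FreeAlgebra F (Fin n) ≃+* MonoidAlgebra F (FreeMonoid (Fin n)) :=
    FreeAlgebra.equivMonoidAlgebraFreeMonoid.toRingEquiv
  obtain ⟨l, hne, hatom, hprod⟩ := (hfull.map_ringEquiv e).exists_list_isAtomMat_of_freeMonoid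
    (by rwa [MulEquiv.isUnit_map])
  refine ⟨l.length, List.length_pos_of_ne_nil hne, fun i => e.symm.mapMatrix (l.get i),
    fun i => (hatom _ (l.get_mem i)).map_ringEquiv e.symm, ?_⟩
  rw [← Function.comp_def, ← List.map_ofFn, List.ofFn_get, ← map_list_prod, hprod]
  ext i j
  simp
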